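/- For any plateau deformation from g' = (V,μ') to g = (V,μ), i.e. any family of Lie brackets μ_t on V, t ∈ [0,1], with t ↦ μ_t(X,Y) continuous for all X,Y ∈ V, μ_0 = μ', (V,μ_t) isomorphic to (V,μ) for all t ∈ (0,1], and (V,μ') not isomorphic to (V,μ), there exists a contraction of g onto g' inverse to it. -/

import Mathlib

open Filter Topology Set

/-- A Lie bracket on a real vector space `V`: a bilinear alternating map satisfying
the Jacobi identity. -/
structure LieBracketOn (V : Type) [AddCommGroup V] [Module ℝ V] : Type where
  br : V →ₗ[ℝ] V →ₗ[ℝ] V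
  alt : ∀ x : V, br x x = 0
  jacobi : ∀ x y z : V, br x (br y z) + br y (br z x) + br z (br x y) = 0

variable {V : Type} [NormedAddCommGroup V] [NormedSpace ℝ V]

/-- `g = (V,μ)` contracts onto `g' = (V,μ')`: there is a family `Φ_t` of linear
automorphisms of `V` such that `Φ_t⁻¹ (μ (Φ_t X) (Φ_t Y)) → μ' X Y` as `t → ∞`. -/
def Contracts (μ μ' : LieBracketOn V) : Prop :=
  ∃ Φ : ℝ → (V ≃ₗ[ℝ] V), ∀ X Y : V,
    Tendsto (fun t : ℝ => (Φ t).symm (μ.br (Φ t X) (Φ t Y))) atTop (𝓝 (μ'.br X Y))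

/-- `(V,μ)` and `(V,μ')` are isomorphic as Lie algebras. -/
def BrIso (μ μ' : LieBracketOn V) : Prop :=
  ∃ e : V ≃ₗ[ℝ] V, ∀ x y : V, e (μ.br x y) = μ'.br (e x) (e y)

/-- `μt` is a deformation of plateau type from `g' = (V,μ')` to `g = (V,μ)`:
`t ↦ μ_t(X,Y)` is continuous on `[0,1]`, `μ_0 = μ'`, `(V,μ_t) ≃ (V,μ)` for all
`t ∈ (0,1]`, and `(V,μ') ≄ (V,μ)`. -/
def IsPlateauDeformation (μ' μ : LieBracketOn V) (μt : ℝ → LieBracketOn V) : Prop :=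
  (∀ X Y : V, ContinuousOn (fun t => (μt t).br X Y) (Icc (0:ℝ) 1)) ∧
  μt 0 = μ' ∧ (∀ t ∈ Ioc (0:ℝ) 1, BrIso (μt t) μ) ∧ ¬ BrIso μ' μ

/-- For any plateau deformation from `g' = (V,μ')` to `g = (V,μ)` there exists a
contraction of `g` onto `g'` inverse to it. -/
theorem plateau_deformation_admits_inverse_contraction [FiniteDimensional ℝ V]
    (μ μ' : LieBracketOn V) (μt : ℝ → LieBracketOn V)
    (h : IsPlateauDeformation μ' μ μt) : Contracts μ μ' := by
  obtain ⟨hcont, h0, hiso, -⟩ := h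
  choose! e he using hiso
  have hinv : Tendsto (fun t : ℝ => t⁻¹) atTop (𝓝[Icc 0 1] 0) := by
    refine tendsto_nhdsWithin_iff.2 ⟨tendsto_inv_atTop_zero, ?_⟩
    filter_upwards [eventually_ge_atTop (1 : ℝ)] with t ht
    exact ⟨by positivity, inv_le_one_of_one_le₀ ht⟩
  refine ⟨fun t => e t⁻¹, fun X Y => ?_⟩
  have hlim := (hcont X Y 0 (by simp)).tendsto.comp hinv
  rw [h0] at hlim
  refine hlim.congr' ?_
  filter_upwards [eventually_ge_atTop (1 : ℝ)] with t ht
  have hmem : t⁻¹ ∈ Ioc (0 : ℝ) 1 := ⟨by positivity, inv_le_one_of_one_le₀ ht⟩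
  simp [← he t⁻¹ hmem X Y]
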